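/- Let H and G be real Hilbert spaces, m ∈ ℕ with m ≥ 1, and let v₁,…,v_m ∈ H and u₁,…,u_m ∈ G. Define the empirical operators Ĉ_vv: H → H by Ĉ_vv f = (1/m) Σ_{j=1}^m ⟨v_j, f⟩ v_j and Ĉ_uv: H → G by Ĉ_uv f = (1/m) Σ_{j=1}^m ⟨v_j, f⟩ u_j, and let K ∈ ℝ^{m×m} be the Gram matrix with entries K_{jj'} = ⟨v_j, v_{j'}⟩. Then for every ε > 0 the matrix K + mεI_m is invertible, and for every x ∈ H, Ĉ_uv (Ĉ_vv + εI)⁻¹ x = Σ_{j=1}^m w_j u_j, where w = (w₁,…,w_m)ᵀ = (K + mεI_m)⁻¹ κ(x) with κ(x) = (⟨v₁, x⟩, …, ⟨v_m, x⟩)ᵀ ∈ ℝ^m. -/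

import Mathlib

open scoped RealInnerProductSpace

/-- finite-sample representation of the Kernel ABC estimator: for feature
vectors `v₁,…,v_m ∈ H`, `u₁,…,u_m ∈ G`, the Gram matrix `K` with `K_{jj'} = ⟪v_j, v_{j'}⟫`,
and `ε > 0`, the matrix `K + mεI` is invertible, and the operator expression
`Ĉ_uv (Ĉ_vv + εI)⁻¹ x` (expressed via the preimage `f` of `x` under `Ĉ_vv + εI`) equals
`Σ_j w_j u_j` with weights `w = (K + mεI)⁻¹ κ(x)`, `κ(x)_j = ⟪v_j, x⟫`. -/
theorem stmt_5
    {H G : Type*}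
    [NormedAddCommGroup H] [InnerProductSpace ℝ H] [CompleteSpace H]
    [NormedAddCommGroup G] [InnerProductSpace ℝ G] [CompleteSpace G]
    (m : ℕ) (hm : 1 ≤ m)
    (v : Fin m → H) (u : Fin m → G)
    (K : Matrix (Fin m) (Fin m) ℝ) (hK : ∀ j j', K j j' = ⟪v j, v j'⟫)
    (ε : ℝ) (hε : 0 < ε) :
    IsUnit (K + ((m : ℝ) * ε) • (1 : Matrix (Fin m) (Fin m) ℝ)) ∧
    ∀ x f : H,
      ((1 : ℝ) / m) • (∑ j, ⟪v j, f⟫ • v j) + ε • f = x →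
      ((1 : ℝ) / m) • (∑ j, ⟪v j, f⟫ • u j) =
        ∑ j, ((K + ((m : ℝ) * ε) • (1 : Matrix (Fin m) (Fin m) ℝ))⁻¹.mulVec
          (fun j' => ⟪v j', x⟫)) j • u j := by
  have hmpos : (0 : ℝ) < m := by exact_mod_cast hm
  have hKg : K = Matrix.gram ℝ v := by
    ext j j'
    rw [hK, Matrix.gram_apply]
  have hpd : (K + ((m : ℝ) * ε) • (1 : Matrix (Fin m) (Fin m) ℝ)).PosDef := by
    rw [hKg]
    exact Matrix.PosDef.posSemidef_add (Matrix.posSemidef_gram ℝ v)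
      (Matrix.PosDef.one.smul (mul_pos hmpos hε))
  have hunit := hpd.isUnit
  refine ⟨hunit, fun x f hx => ?_⟩
  have hdet := (Matrix.isUnit_iff_isUnit_det _).1 hunit
  have key : (fun j' => ⟪v j', x⟫) =
      (K + ((m : ℝ) * ε) • (1 : Matrix (Fin m) (Fin m) ℝ)).mulVec
        (fun j => (1 / (m : ℝ)) * ⟪v j, f⟫) := by
    ext i
    rw [← hx, Matrix.add_mulVec, Matrix.smul_mulVec, Matrix.one_mulVec]
    simp only [inner_add_right, inner_smul_right, inner_sum, Pi.add_apply, Pi.smul_apply,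
      Matrix.mulVec, dotProduct, hK, smul_eq_mul, Finset.mul_sum]
    congr 1
    · exact Finset.sum_congr rfl fun j _ => by ring
    · field_simp
  rw [key, Matrix.mulVec_mulVec, Matrix.nonsing_inv_mul _ hdet, Matrix.one_mulVec,
    Finset.smul_sum]
  simp only [smul_smul]
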